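/- There exists N such that for every n ≥ N the following holds in the (1,3,n)-LRM scheme: for every word g' = (g_0, …, g_{n-3}) over {0,1,2} of length n-2 that contains (2,0,1,1) as a contiguous subsequence, there are at least 9 distinct legal codewords g of length n whose first n-2 symbols equal g'. Consequently, the number M_3(n) of legal codewords satisfies M_3(n) ≥ 9·M'(n), where M'(n) is the number of words of length n-2 over {0,1,2} containing (2,0,1,1) as a contiguous subsequence. -/

import Mathlib

/-- A cyclic charge sequence `c : ZMod n → ℤ` has pairwise distinct values in every
window of three cyclically consecutive cells. -/
def DistinctWindows3 (n : ℕ) (c : ZMod n → ℤ) : Prop :=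
  ∀ i : ZMod n, ∀ k l : Fin 3, k ≠ l →
    c (i + ((k : ℕ) : ZMod n)) ≠ c (i + ((l : ℕ) : ZMod n))

/-- A word `g` of length `n` over `{0,1,2}` is a legal codeword in the `(1,3,n)`-LRM
scheme: it is induced by some charge sequence `c` with pairwise distinct values in each
window of three cyclically consecutive cells, via
`g i = |{ j ∈ {i, i+1} : c j < c (i+2) }|`. -/
def LegalCodeword3 (n : ℕ) (g : ZMod n → Fin 3) : Prop :=
  ∃ c : ZMod n → ℤ, DistinctWindows3 n c ∧
    ∀ i : ZMod n,
      (g i : ℕ) =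
        (Finset.univ.filter (fun j : Fin 2 => c (i + ((j : ℕ) : ZMod n)) < c (i + 2))).card

/-- The word `s` of length `m` over the alphabet `{0,1,2}` contains
`(2,0,1,1)` as a contiguous subsequence. -/
def Contains2011 {m : ℕ} (s : Fin m → Fin 3) : Prop :=
  ∃ i : ℕ, ∃ h : i + 3 < m,
    s ⟨i, by omega⟩ = 2 ∧ s ⟨i + 1, by omega⟩ = 0 ∧
    s ⟨i + 2, by omega⟩ = 1 ∧ s ⟨i + 3, h⟩ = 1

/-- `M₃' n` is the number of legal codewords of length `n` in the `(1,3,n)`-LRM scheme. -/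
noncomputable def M₃' (n : ℕ) : ℕ :=
  Nat.card {g : ZMod n → Fin 3 // LegalCodeword3 n g}

/-- `M' n` is the number of words of length `n - 2` over `{0,1,2}` that contain
`(2,0,1,1)` as a contiguous subsequence. -/
noncomputable def M' (n : ℕ) : ℕ :=
  Nat.card {s : Fin (n - 2) → Fin 3 // Contains2011 s}

def RelR (x : Fin 3) (a b c : ℤ) : Prop :=
  (x = 0 ∧ c < a ∧ c < b) ∨ (x = 1 ∧ ((a < c ∧ c < b) ∨ (b < c ∧ c < a))) ∨
    (x = 2 ∧ a < c ∧ b < c)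

theorem exists_step (x : Fin 3) (a b : ℤ) (h : a ≠ b) :
    ∃ c : ℤ, RelR x (2 * a) (2 * b) c ∧ 2 * b ≠ c := by
  unfold RelR
  fin_cases x
  · refine ⟨2 * min a b - 1, Or.inl ⟨rfl, ?_, ?_⟩, ?_⟩ <;> omega
  · refine ⟨a + b, Or.inr (Or.inl ⟨rfl, ?_⟩), ?_⟩ <;> omega
  · refine ⟨2 * max a b + 1, Or.inr (Or.inr ⟨rfl, ?_, ?_⟩), ?_⟩ <;> omega

theorem RelR_double {x : Fin 3} {a b c : ℤ} (h : RelR x a b c) :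
    RelR x (2 * a) (2 * b) (2 * c) := by
  unfold RelR at *
  omega

theorem exists_chain (g : ℕ → Fin 3) (m : ℕ) :
    ∃ c : ℕ → ℤ, c 1 < c 0 ∧ c m ≠ c (m + 1) ∧
      ∀ i < m, RelR (g i) (c i) (c (i + 1)) (c (i + 2)) := by
  induction m with
  | zero => exact ⟨fun i => - (i : ℤ), by simp, by simp, by simp⟩
  | succ m ih =>
    obtain ⟨c, h0, h1, h2⟩ := ih
    obtain ⟨d, hd, hd'⟩ := exists_step (g m) _ _ h1
    refine ⟨fun j => if j = m + 2 then d else 2 * c j, ?_, ?_, ?_⟩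
    · have e1 : ¬ (1 = m + 2) := by omega
      have e0 : ¬ (0 = m + 2) := by omega
      simp only [e1, e0, if_false]; omega
    · have e1 : ¬ (m + 1 = m + 2) := by omega
      simp only [e1, if_false]
      simpa using hd'
    · intro i hi
      have e0 : ¬ (i = m + 2) := by omega
      have e1 : ¬ (i + 1 = m + 2) := by omega
      simp only [e0, e1, if_false]
      by_cases him : i = m
      · subst him; simpa using hd
      · have e2 : ¬ (i + 2 = m + 2) := by omega
        simp only [e2, if_false]
        exact RelR_double (h2 i (by omega))

theorem exists_bd (c : ℕ → ℤ) (n : ℕ) : ∃ B : ℤ, ∀ j < n, c j < B ∧ -B < c j := by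
  induction n with
  | zero => exact ⟨0, by simp⟩
  | succ n ih =>
    obtain ⟨B, hB⟩ := ih
    refine ⟨max B (|c n| + 1), fun j hj => ?_⟩
    by_cases h : j = n
    · subst h
      have := le_abs_self (c j)
      have := neg_abs_le (c j)
      omega
    · have := hB j (by omega)
      omega

theorem exists_cyc (g : ℕ → Fin 3) (m : ℕ) (h2 : g (m + 2) = 2) (h0 : g (m + 3) = 0)
    (h1 : g (m + 4) = 1) (h1' : g (m + 5) = 1) :
    ∃ c : ℕ → ℤ, ∀ t < m + 6,
      RelR (g t) (c t) (c ((t + 1) % (m + 6))) (c ((t + 2) % (m + 6))) := by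
  obtain ⟨c, hc, -, hr⟩ := exists_chain g (m + 2)
  obtain ⟨B, hB⟩ := exists_bd c (m + 4)
  refine ⟨fun j => if j = m + 4 then B else if j = m + 5 then -B else c j, fun t ht => ?_⟩
  have b0 := hB 0 (by omega)
  have b1 := hB 1 (by omega)
  have b2 := hB (m + 2) (by omega)
  have b3 := hB (m + 3) (by omega)
  by_cases t1 : t < m + 2
  · rw [Nat.mod_eq_of_lt (by omega), Nat.mod_eq_of_lt (by omega)]
    have := hr t t1
    simp only [show t ≠ m + 4 by omega, show t ≠ m + 5 by omega, show t + 1 ≠ m + 4 by omega,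
      show t + 1 ≠ m + 5 by omega, show t + 2 ≠ m + 4 by omega, show t + 2 ≠ m + 5 by omega,
      if_false]
    exact this
  obtain rfl | rfl | rfl | rfl : t = m + 2 ∨ t = m + 3 ∨ t = m + 4 ∨ t = m + 5 := by omega
  · rw [Nat.mod_eq_of_lt (by omega), Nat.mod_eq_of_lt (by omega)]
    have b3' : c (m + 2 + 1) < B := b3.1
    simp [RelR, h2]; omega
  · rw [Nat.mod_eq_of_lt (by omega), Nat.mod_eq_of_lt (by omega)]
    simp [RelR, h0]; omega
  · rw [Nat.mod_eq_of_lt (by omega), show m + 4 + 2 = m + 6 by omega, Nat.mod_self]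
    simp [RelR, h1]; omega
  · rw [show m + 5 + 1 = m + 6 by omega, Nat.mod_self,
      show m + 5 + 2 = 1 + (m + 6) by omega, Nat.add_mod_right, Nat.mod_eq_of_lt (by omega)]
    simp [RelR, h1']; omega

theorem legal_of_RelR (n : ℕ) (g : ZMod n → Fin 3) (c : ZMod n → ℤ)
    (h : ∀ i, RelR (g i) (c i) (c (i + 1)) (c (i + 2))) : LegalCodeword3 n g := by
  refine ⟨c, ?_, ?_⟩
  · intro i k l hkl
    have := h i
    have ne : c i ≠ c (i + 1) := by
      have := h (i - 1)
      rw [show i - 1 + 1 = i by ring, show i - 1 + 2 = i + 1 by ring] at this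
      unfold RelR at this
      omega
    unfold RelR at this
    fin_cases k <;> fin_cases l <;> simp at hkl ⊢ <;> omega
  · intro i
    have := h i
    rw [Finset.card_filter, Fin.sum_univ_two]
    simp only [Fin.val_zero, Fin.val_one, Nat.cast_zero, Nat.cast_one, add_zero]
    rcases this with ⟨e, h1, h2⟩ | ⟨e, ⟨h1, h2⟩ | ⟨h1, h2⟩⟩ | ⟨e, h1, h2⟩
    · rw [e, if_neg (by omega), if_neg (by omega)]; rfl
    · rw [e, if_pos (by omega), if_neg (by omega)]; rfl
    · rw [e, if_neg (by omega), if_pos (by omega)]; rfl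
    · rw [e, if_pos (by omega), if_pos (by omega)]; rfl

theorem legal_of_pattern (m : ℕ) (g : ZMod (m + 6) → Fin 3) (k : ZMod (m + 6))
    (h2 : g k = 2) (h0 : g (k + 1) = 0) (h1 : g (k + 2) = 1) (h1' : g (k + 3) = 1) :
    LegalCodeword3 (m + 6) g := by
  have hz : (m : ZMod (m + 6)) + 6 = 0 := by
    have := ZMod.natCast_self (m + 6)
    push_cast at this
    exact this
  obtain ⟨c, hc⟩ := exists_cyc (fun t => g (k + 4 + t)) m
    (by rw [← h2]; congr 1; push_cast; linear_combination hz)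
    (by rw [← h0]; congr 1; push_cast; linear_combination hz)
    (by rw [← h1]; congr 1; push_cast; linear_combination hz)
    (by rw [← h1']; congr 1; push_cast; linear_combination hz)
  refine legal_of_RelR _ g (fun z => c (z - (k + 4)).val) fun i => ?_
  have := hc (i - (k + 4)).val (ZMod.val_lt _)
  simp only [ZMod.natCast_zmod_val] at this
  rw [show k + 4 + (i - (k + 4)) = i by ring] at this
  have e : ∀ j : ℕ, ((i - (k + 4)).val + j) % (m + 6) = (i + j - (k + 4)).val := by
    intro j
    rw [← ZMod.val_natCast]
    congr 1
    push_cast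
    rw [ZMod.natCast_zmod_val]
    ring
  rw [e 1, e 2] at this
  simpa using this

/-- The extension of a word by two letters. -/
def extW (n : ℕ) (s : Fin (n - 2) → Fin 3) (a b : Fin 3) : ZMod n → Fin 3 := fun z =>
  if h : z.val < n - 2 then s ⟨z.val, h⟩ else if z.val = n - 2 then a else b

theorem extW_nat (n : ℕ) (s : Fin (n - 2) → Fin 3) (a b : Fin 3) (i : ℕ) (h : i < n - 2) :
    extW n s a b (i : ZMod n) = s ⟨i, h⟩ := by
  have : (i : ZMod n).val = i := ZMod.val_natCast_of_lt (by omega)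
  simp [extW, this, h]

theorem extW_inj (n : ℕ) (hn : 6 ≤ n) (s s' : Fin (n - 2) → Fin 3) (a b a' b' : Fin 3)
    (h : extW n s a b = extW n s' a' b') : s = s' ∧ a = a' ∧ b = b' := by
  refine ⟨?_, ?_, ?_⟩
  · funext i
    have := congrFun h ((i : ℕ) : ZMod n)
    rwa [extW_nat _ _ _ _ _ i.2, extW_nat _ _ _ _ _ i.2] at this
  · have := congrFun h ((n - 2 : ℕ) : ZMod n)
    have e : ((n - 2 : ℕ) : ZMod n).val = n - 2 := ZMod.val_natCast_of_lt (by omega)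
    simpa [extW, e] using this
  · have := congrFun h ((n - 1 : ℕ) : ZMod n)
    have e : ((n - 1 : ℕ) : ZMod n).val = n - 1 := ZMod.val_natCast_of_lt (by omega)
    simpa [extW, e, show ¬ (n - 1 < n - 2) by omega, show ¬ (n - 1 = n - 2) by omega] using this

theorem extW_legal (n : ℕ) (hn : 6 ≤ n) (s : Fin (n - 2) → Fin 3) (hs : Contains2011 s)
    (a b : Fin 3) : LegalCodeword3 n (extW n s a b) := by
  obtain ⟨i, h, h2, h0, h1, h1'⟩ := hs
  obtain ⟨m, rfl⟩ : ∃ m, n = m + 6 := ⟨n - 6, by omega⟩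
  refine legal_of_pattern m _ (i : ZMod (m + 6)) ?_ ?_ ?_ ?_
  · rw [extW_nat _ _ _ _ i (by omega), h2]
  · have := extW_nat _ s a b (i + 1) (by omega)
    push_cast at this
    rw [this, h0]
  · have := extW_nat _ s a b (i + 2) (by omega)
    push_cast at this
    rw [this, h1]
  · have := extW_nat _ s a b (i + 3) (by omega)
    push_cast at this
    rw [this, h1']

/-- For all sufficiently large `n`: every word of length `n - 2` over `{0,1,2}`
containing `(2,0,1,1)` as a contiguous subsequence extends to at least `9` distinct
legal codewords of the `(1,3,n)`-LRM scheme; consequently `M₃' n ≥ 9 * M' n`. -/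
theorem nine_extensions_of_pattern_words :
    ∃ N : ℕ, ∀ n : ℕ, N ≤ n →
      (∀ g' : Fin (n - 2) → Fin 3, Contains2011 g' →
        9 ≤ Nat.card {g : ZMod n → Fin 3 //
              LegalCodeword3 n g ∧ ∀ i : Fin (n - 2), g ((i : ℕ) : ZMod n) = g' i}) ∧
      9 * M' n ≤ M₃' n := by
  refine ⟨6, fun n hn => ?_⟩
  have : NeZero n := ⟨by omega⟩
  refine ⟨fun g' hg => ?_, ?_⟩
  · have := Nat.card_le_card_of_injective
      (fun p : Fin 3 × Fin 3 => (⟨extW n g' p.1 p.2, extW_legal n hn g' hg p.1 p.2,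
        fun i => extW_nat n g' p.1 p.2 i i.2⟩ : {g : ZMod n → Fin 3 //
              LegalCodeword3 n g ∧ ∀ i : Fin (n - 2), g ((i : ℕ) : ZMod n) = g' i}))
      (by
        intro p q hpq
        have := extW_inj n hn _ _ _ _ _ _ (Subtype.ext_iff.1 hpq)
        exact Prod.ext this.2.1 this.2.2)
    simpa using this
  · have := Nat.card_le_card_of_injective
      (fun p : (Fin 3 × Fin 3) × {s : Fin (n - 2) → Fin 3 // Contains2011 s} =>
        (⟨extW n p.2.1 p.1.1 p.1.2, extW_legal n hn p.2.1 p.2.2 p.1.1 p.1.2⟩ :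
          {g : ZMod n → Fin 3 // LegalCodeword3 n g}))
      (by
        intro p q hpq
        have := extW_inj n hn _ _ _ _ _ _ (Subtype.ext_iff.1 hpq)
        exact Prod.ext (Prod.ext this.2.1 this.2.2) (Subtype.ext this.1))
    rw [Nat.card_prod] at this
    have e : Nat.card (Fin 3 × Fin 3) = 9 := by simp
    rw [e] at this
    exact this
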